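/- Let E be a metric space, let p and q be Borel probability measures on E, let α ∈ (0,1], let L ≥ 0, and let f₀, f₁ : E → ℝ be bounded L-Lipschitz functions. Suppose ε ≥ 0 is such that |∫ h dp − ∫ h dq| ≤ ε for every bounded 1-Lipschitz function h : E → ℝ. Then |(CVaR_{p,α}(f₁) − CVaR_{p,α}(f₀)) − (CVaR_{q,α}(f₁) − CVaR_{q,α}(f₀))| ≤ (2L/α)·ε. -/

import Mathlib

open MeasureTheory

noncomputable def cvar {Ω : Type*} [MeasurableSpace Ω] (μ : Measure Ω) (α : ℝ)
    (Y : Ω → ℝ) : ℝ :=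
  ⨅ η : ℝ, (η + α⁻¹ * ∫ ω, max (Y ω - η) 0 ∂μ)

theorem integrable_of_lipschitzWith_of_bounded {E : Type*} [MetricSpace E] [MeasurableSpace E]
    [BorelSpace E] (p : Measure E) [IsFiniteMeasure p] {K : NNReal} {g : E → ℝ}
    (hgb : ∃ C : ℝ, ∀ x, |g x| ≤ C) (hgL : LipschitzWith K g) : Integrable g p := by
  obtain ⟨C, hC⟩ := hgb
  exact Integrable.of_bound hgL.continuous.measurable.aestronglyMeasurable C
    (Filter.Eventually.of_forall hC)

theorem abs_integral_sub_integral_le_mul {E : Type*} [MetricSpace E] [MeasurableSpace E]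
    (p q : Measure E) [IsProbabilityMeasure p] [IsProbabilityMeasure q]
    {ε : ℝ}
    (hW : ∀ h : E → ℝ, (∃ C : ℝ, ∀ x, |h x| ≤ C) → LipschitzWith 1 h →
      |(∫ x, h x ∂p) - (∫ x, h x ∂q)| ≤ ε)
    {K : NNReal} {g : E → ℝ} (hgb : ∃ C : ℝ, ∀ x, |g x| ≤ C) (hgL : LipschitzWith K g) :
    |(∫ x, g x ∂p) - (∫ x, g x ∂q)| ≤ K * ε := by
  rcases eq_or_ne K 0 with rfl | hK
  · obtain ⟨x₀⟩ := nonempty_of_isProbabilityMeasure p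
    have hconst : g = fun _ => g x₀ := by
      funext x
      have h := hgL.dist_le_mul x x₀
      rw [NNReal.coe_zero, zero_mul] at h
      exact dist_le_zero.mp h
    rw [hconst]
    simp
  · have hKpos : (0 : ℝ) < K := NNReal.coe_pos.mpr (pos_iff_ne_zero.mpr hK)
    obtain ⟨C, hC⟩ := hgb
    have h := hW (fun x => (K : ℝ)⁻¹ * g x) ⟨(K : ℝ)⁻¹ * C, fun x => by
      rw [abs_mul, abs_of_pos (inv_pos.mpr hKpos)]
      exact mul_le_mul_of_nonneg_left (hC x) (inv_pos.mpr hKpos).le⟩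
      (LipschitzWith.of_dist_le_mul fun x y => by
        rw [Real.dist_eq, ← mul_sub, abs_mul, abs_of_pos (inv_pos.mpr hKpos),
          NNReal.coe_one, one_mul, inv_mul_le_iff₀ hKpos, ← Real.dist_eq]
        exact hgL.dist_le_mul x y)
    rwa [integral_const_mul, integral_const_mul, ← mul_sub, abs_mul,
      abs_of_pos (inv_pos.mpr hKpos), inv_mul_le_iff₀ hKpos] at h

theorem exists_bound_max_sub_zero {E : Type*} {f : E → ℝ} (hfb : ∃ C : ℝ, ∀ x, |f x| ≤ C)
    (η : ℝ) : ∃ C : ℝ, ∀ x, |max (f x - η) 0| ≤ C := by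
  obtain ⟨C, hC⟩ := hfb
  refine ⟨C + |η|, fun x => ?_⟩
  rw [abs_of_nonneg (le_max_right _ _)]
  have hx := hC x
  have h₀ := abs_nonneg (f x)
  have h₁ := le_abs_self (f x)
  have h₂ := neg_abs_le η
  have h₃ := abs_nonneg η
  exact max_le (by linarith) (by linarith)

theorem LipschitzWith.max_sub_zero {E : Type*} [MetricSpace E] {K : NNReal} {f : E → ℝ}
    (hf : LipschitzWith K f) (η : ℝ) : LipschitzWith K fun x => max (f x - η) 0 :=
  LipschitzWith.max_const (LipschitzWith.of_dist_le_mul fun x y => by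
    simpa [dist_sub_right] using hf.dist_le_mul x y) 0

theorem bddBelow_range_cvar_objective {E : Type*} [MetricSpace E] [MeasurableSpace E]
    [BorelSpace E] (p : Measure E) [IsProbabilityMeasure p] {α : ℝ}
    (hα : α ∈ Set.Ioc (0 : ℝ) 1) {K : NNReal} {f : E → ℝ}
    (hfb : ∃ C : ℝ, ∀ x, |f x| ≤ C) (hfL : LipschitzWith K f) :
    BddBelow (Set.range fun η : ℝ => η + α⁻¹ * ∫ x, max (f x - η) 0 ∂p) := by
  refine ⟨∫ x, f x ∂p, ?_⟩
  rintro _ ⟨η, rfl⟩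
  have hf := integrable_of_lipschitzWith_of_bounded p hfb hfL
  have hle : ∫ x, (f x - η) ∂p ≤ ∫ x, max (f x - η) 0 ∂p :=
    integral_mono (hf.sub (integrable_const η))
      (integrable_of_lipschitzWith_of_bounded p (exists_bound_max_sub_zero hfb η)
        (hfL.max_sub_zero η)) fun x => le_max_left _ _
  rw [integral_sub hf (integrable_const η), integral_const, probReal_univ, one_smul] at hle
  have hnonneg : 0 ≤ ∫ x, max (f x - η) 0 ∂p := integral_nonneg fun x => le_max_right _ _
  have hscale := le_mul_of_one_le_left hnonneg ((one_le_inv₀ hα.1).mpr hα.2)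
  dsimp only
  linarith

theorem cvar_le_cvar_add {E : Type*} [MetricSpace E] [MeasurableSpace E]
    [BorelSpace E] (p q : Measure E) [IsProbabilityMeasure p] [IsProbabilityMeasure q] {α : ℝ}
    (hα : α ∈ Set.Ioc (0 : ℝ) 1) {K : NNReal} {f : E → ℝ}
    (hfb : ∃ C : ℝ, ∀ x, |f x| ≤ C) (hfL : LipschitzWith K f) {ε : ℝ}
    (hW : ∀ h : E → ℝ, (∃ C : ℝ, ∀ x, |h x| ≤ C) → LipschitzWith 1 h →
      |(∫ x, h x ∂p) - (∫ x, h x ∂q)| ≤ ε) :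
    cvar p α f ≤ cvar q α f + α⁻¹ * (K * ε) := by
  rw [← sub_le_iff_le_add]
  refine le_ciInf fun η => ?_
  have hp : cvar p α f ≤ η + α⁻¹ * ∫ x, max (f x - η) 0 ∂p :=
    ciInf_le (bddBelow_range_cvar_objective p hα hfb hfL) η
  have hgap := (abs_le.mp (abs_integral_sub_integral_le_mul p q hW
    (exists_bound_max_sub_zero hfb η) (hfL.max_sub_zero η))).2
  have hscale := mul_le_mul_of_nonneg_left hgap (inv_pos.mpr hα.1).le
  rw [mul_sub] at hscale
  linarith

theorem abs_cvar_sub_cvar_le {E : Type*} [MetricSpace E] [MeasurableSpace E]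
    [BorelSpace E] (p q : Measure E) [IsProbabilityMeasure p] [IsProbabilityMeasure q] {α : ℝ}
    (hα : α ∈ Set.Ioc (0 : ℝ) 1) {K : NNReal} {f : E → ℝ}
    (hfb : ∃ C : ℝ, ∀ x, |f x| ≤ C) (hfL : LipschitzWith K f) {ε : ℝ}
    (hW : ∀ h : E → ℝ, (∃ C : ℝ, ∀ x, |h x| ≤ C) → LipschitzWith 1 h →
      |(∫ x, h x ∂p) - (∫ x, h x ∂q)| ≤ ε) :
    |cvar p α f - cvar q α f| ≤ α⁻¹ * (K * ε) := by
  have hpq := cvar_le_cvar_add p q hα hfb hfL hW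
  have hqp := cvar_le_cvar_add q p hα hfb hfL fun h hb hl => by
    rw [abs_sub_comm]
    exact hW h hb hl
  exact abs_sub_le_iff.mpr ⟨by linarith, by linarith⟩

theorem cvar_regret_gap_wasserstein_bound {E : Type*} [MetricSpace E] [MeasurableSpace E]
    [BorelSpace E]
    (p q : Measure E) [IsProbabilityMeasure p] [IsProbabilityMeasure q]
    (α : ℝ) (hα : α ∈ Set.Ioc (0 : ℝ) 1)
    (L : ℝ) (hL : 0 ≤ L)
    (f₀ f₁ : E → ℝ)
    (hf₀b : ∃ C : ℝ, ∀ x, |f₀ x| ≤ C) (hf₀L : LipschitzWith (Real.toNNReal L) f₀)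
    (hf₁b : ∃ C : ℝ, ∀ x, |f₁ x| ≤ C) (hf₁L : LipschitzWith (Real.toNNReal L) f₁)
    (ε : ℝ) (hε : 0 ≤ ε)
    (hW : ∀ h : E → ℝ, (∃ C : ℝ, ∀ x, |h x| ≤ C) → LipschitzWith 1 h →
      |(∫ x, h x ∂p) - (∫ x, h x ∂q)| ≤ ε) :
    |(cvar p α f₁ - cvar p α f₀) - (cvar q α f₁ - cvar q α f₀)| ≤ (2 * L / α) * ε := by
  have h₀ := abs_le.mp (abs_cvar_sub_cvar_le p q hα hf₀b hf₀L hW)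
  have h₁ := abs_le.mp (abs_cvar_sub_cvar_le p q hα hf₁b hf₁L hW)
  rw [Real.coe_toNNReal L hL] at h₀ h₁
  have hbound : 2 * L / α * ε = α⁻¹ * (L * ε) + α⁻¹ * (L * ε) := by ring
  rw [hbound]
  exact abs_le.mpr ⟨by linarith [h₀.2, h₁.1], by linarith [h₀.1, h₁.2]⟩
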